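/- arXiv:2401.14505 — 7 statements merged into one kernel-verified Lean document; each statement's English description precedes it below -/
import Mathlib

section
/- For any Schur matrix A ∈ ℝ^{n×n}, there exist a sequence of invertible real matrices (R_k)_{k∈ℕ} in ℝ^{n×n}, a scalar σ > 0, and a constant matrix N ∈ ℝ^{n×n} that is entrywise nonnegative and Schur, such that for all k ∈ ℕ: ‖R_k‖ + ‖R_k⁻¹‖ ≤ σ and R_{k+1} A R_k⁻¹ = N. -/
open Matrix

attribute [local instance] Matrix.linftyOpNormedAddCommGroup

/-- A real square matrix is Schur if all of its complex eigenvalues have modulus `< 1`,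
i.e. its spectral radius is strictly less than `1`. -/
def IsSchur {n : ℕ} (A : Matrix (Fin n) (Fin n) ℝ) : Prop :=
  ∀ μ ∈ spectrum ℂ (A.map (algebraMap ℝ ℂ)), ‖μ‖ < 1

section
open Polynomial

theorem Finset.exists_real_polynomial_aeval_eq (s : Finset ℂ)
    (hs : ∀ z ∈ s, starRingEnd ℂ z ∈ s) (φ : ℂ → ℂ)
    (hφ : ∀ z, φ (starRingEnd ℂ z) = starRingEnd ℂ (φ z)) :
    ∃ p : ℝ[X], ∀ z ∈ s, aeval z p = φ z := by
  have inj : Set.InjOn (id : ℂ → ℂ) s := Set.injOn_id _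
  set P := Lagrange.interpolate s id φ with hP
  have hconj : P.map (starRingEnd ℂ) = P := by
    refine Lagrange.eq_interpolate_of_eval_eq φ inj ?_ fun z hz => ?_
    · exact (degree_map_le).trans_lt (Lagrange.degree_interpolate_lt φ inj)
    · have h := Lagrange.eval_interpolate_at_node φ inj (hs z hz)
      rw [id, ← hP] at h
      rw [id, ← Complex.conj_conj z, eval_map_apply, h, hφ, Complex.conj_conj,
        Complex.conj_conj]
  have hlift : P ∈ lifts (algebraMap ℝ ℂ) := by
    rw [lifts_iff_coeff_lifts]
    intro i
    have h := congrArg (fun Q : ℂ[X] => Q.coeff i) hconj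
    simp only [coeff_map] at h
    exact ⟨(P.coeff i).re, Complex.conj_eq_iff_re.1 h⟩
  obtain ⟨p, hp⟩ := (mem_lifts _).1 hlift
  refine ⟨p, fun z hz => ?_⟩
  rw [aeval_def, ← eval_map, hp]
  exact Lagrange.eval_interpolate_at_node φ inj hz

theorem Polynomial.Separable.dvd_of_roots_subset {K : Type*} [Field K] {m r : K[X]}
    (hm : m.Separable) (hs : m.Splits) (h : ∀ z ∈ m.roots, r.eval z = 0) : m ∣ r := by
  rcases eq_or_ne r 0 with rfl | hr
  · exact dvd_zero _
  · refine Splits.dvd_of_roots_le_roots hs hm.ne_zero ?_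
    refine (Multiset.le_iff_subset (nodup_roots hm)).2 fun z hz => ?_
    exact (mem_roots hr).2 (h z hz)

theorem Polynomial.Separable.dvd_of_aroots_subset {m r : ℝ[X]}
    (hm : m.Separable) (h : ∀ z ∈ m.aroots ℂ, aeval z r = 0) : m ∣ r := by
  rw [← map_dvd_map' (algebraMap ℝ ℂ)]
  refine hm.map.dvd_of_roots_subset (IsAlgClosed.splits _) fun z hz => ?_
  rw [eval_map_algebraMap]
  exact h z hz

theorem Polynomial.Separable.aeval_eq_of_aroots {R : Type*} [Ring R] [Algebra ℝ R]
    {m p q : ℝ[X]} (hm : m.Separable) {S : R} (hS : aeval S m = 0)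
    (h : ∀ z ∈ m.aroots ℂ, aeval z p = aeval z q) : aeval S p = aeval S q := by
  rw [← sub_eq_zero, ← map_sub]
  obtain ⟨c, hc⟩ := hm.dvd_of_aroots_subset (r := p - q)
    fun z hz => by rw [map_sub, h z hz, sub_self]
  rw [hc, map_mul, hS, zero_mul]

theorem Matrix.linfty_opNorm_map_ofReal {n : ℕ} (M : Matrix (Fin n) (Fin n) ℝ) :
    ‖M.map (algebraMap ℝ ℂ)‖ = ‖M‖ := by
  simp [Matrix.linfty_opNorm_def]

theorem Matrix.map_algebraMap_aeval {n : ℕ} (S : Matrix (Fin n) (Fin n) ℝ) (p : ℝ[X]) :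
    (aeval S p).map (algebraMap ℝ ℂ)
      = aeval (S.map (algebraMap ℝ ℂ)) (p.map (algebraMap ℝ ℂ)) := by
  rw [aeval_map_algebraMap]
  exact (aeval_algHom_apply (Algebra.ofId ℝ ℂ).mapMatrix S p).symm

theorem Polynomial.Separable.exists_norm_aeval_pow_le {n : ℕ} {S : Matrix (Fin n) (Fin n) ℝ}
    {m p : ℝ[X]} (hm : m.Separable) (hS : aeval S m = 0)
    (h : ∀ z ∈ m.aroots ℂ, ‖aeval z p‖ ≤ 1) : ∃ c, ∀ k : ℕ, ‖aeval S p ^ k‖ ≤ c := by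
  let _ := Matrix.linftyOpNormedSpace (R := ℂ) (m := Fin n) (n := Fin n) (α := ℂ)
  set Λ := (m.aroots ℂ).toFinset
  set S' := S.map (algebraMap ℝ ℂ) with hS'
  have hmS' : aeval S' (m.map (algebraMap ℝ ℂ)) = 0 := by
    rw [← Matrix.map_algebraMap_aeval, hS]; simp
  refine ⟨∑ z ∈ Λ, ‖aeval S' (Lagrange.basis Λ id z)‖, fun k => ?_⟩
  have key : (aeval S p ^ k).map (algebraMap ℝ ℂ)
      = ∑ z ∈ Λ, aeval z p ^ k • aeval S' (Lagrange.basis Λ id z) := by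
    rw [← map_pow, Matrix.map_algebraMap_aeval, ← hS', ← sub_eq_zero]
    obtain ⟨c, hc⟩ := hm.map.dvd_of_roots_subset (IsAlgClosed.splits (m.map (algebraMap ℝ ℂ)))
      (r := (p ^ k).map (algebraMap ℝ ℂ) - Lagrange.interpolate Λ id fun z => aeval z p ^ k)
      fun z hz => by
        have := Lagrange.eval_interpolate_at_node (fun z => aeval z p ^ k)
          (Set.injOn_id (Λ : Set ℂ)) (Multiset.mem_toFinset.2 hz)
        rw [eval_sub, eval_map_algebraMap, map_pow]
        rw [id] at this
        rw [this, sub_self]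
    have h0 := congrArg (aeval S') hc
    rw [map_mul, hmS', zero_mul, map_sub, Lagrange.interpolate_apply, map_sum] at h0
    simpa [aeval_C, ← map_pow, ← Algebra.smul_def] using h0
  rw [← Matrix.linfty_opNorm_map_ofReal, key]
  refine norm_sum_le_of_le _ fun z hz => ?_
  rw [norm_smul, norm_pow]
  exact mul_le_of_le_one_left (norm_nonneg _)
    (pow_le_one₀ (norm_nonneg _) (h z (Multiset.mem_toFinset.1 hz)))

/-- An `ℝ[X]`-module has a nonnegative basis if, in some finite real basis, multiplication by `X` is
given by an entrywise nonnegative matrix. -/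
def Polynomial.HasNonnegBasis (M : Type*) [AddCommGroup M] [Module ℝ M] [Module ℝ[X] M] : Prop :=
  ∃ (ι : Type) (_ : Fintype ι) (b : Module.Basis ι ℝ M), ∀ i j, 0 ≤ b.repr ((X : ℝ[X]) • b j) i

namespace Polynomial.HasNonnegBasis

theorem of_linearEquiv {M N : Type*} [AddCommGroup M] [Module ℝ M] [Module ℝ[X] M]
    [AddCommGroup N] [Module ℝ N] [Module ℝ[X] N] [IsScalarTower ℝ ℝ[X] M]
    [IsScalarTower ℝ ℝ[X] N]
    (h : HasNonnegBasis M) (e : N ≃ₗ[ℝ[X]] M) : HasNonnegBasis N := by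
  obtain ⟨ι, hι, b, hb⟩ := h
  refine ⟨ι, hι, b.map (e.restrictScalars ℝ).symm, fun i j => ?_⟩
  simpa using hb i j

theorem pi {ι : Type} [Finite ι] {M : ι → Type*} [∀ i, AddCommGroup (M i)]
    [∀ i, Module ℝ (M i)] [∀ i, Module ℝ[X] (M i)] (h : ∀ i, HasNonnegBasis (M i)) :
    HasNonnegBasis (∀ i, M i) := by
  classical
  have := Fintype.ofFinite ι
  choose κ hκ b hb using h
  refine ⟨Σ i, κ i, inferInstance, Pi.basis b, ?_⟩
  rintro ⟨i, k⟩ ⟨j, l⟩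
  rw [Pi.basis_repr, Pi.basis_apply, Pi.smul_apply]
  rcases eq_or_ne i j with rfl | hij
  · simpa using hb i k l
  · simp [Pi.single_eq_of_ne hij]

theorem quotient_X_sub_C_pow {d : ℝ} (hd : 0 ≤ d) (e : ℕ) :
    HasNonnegBasis (ℝ[X] ⧸ Ideal.span {(X - C d) ^ e}) := by
  have hmon : (X ^ e : ℝ[X]).Monic := monic_X_pow e
  let pb := AdjoinRoot.powerBasis' hmon
  let E : (ℝ[X] ⧸ Ideal.span {(X - C d) ^ e}) ≃ₐ[ℝ] (ℝ[X] ⧸ Ideal.span {(X ^ e : ℝ[X])}) :=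
    Ideal.quotientEquivAlg _ _ (algEquivAevalXAddC d) (by
      rw [Ideal.map_span]; simp)
  let E' : (ℝ[X] ⧸ Ideal.span {(X - C d) ^ e}) ≃ₗ[ℝ] AdjoinRoot (X ^ e : ℝ[X]) := E.toLinearEquiv
  have hE : ∀ y, E' ((X : ℝ[X]) • y) = AdjoinRoot.root (X ^ e) * E' y + d • E' y := by
    intro y
    have h1 : (X : ℝ[X]) • y = Ideal.Quotient.mk _ X * y := rfl
    have h2 : E (Ideal.Quotient.mk _ X) = Ideal.Quotient.mk _ (X + C d) := by
      simp [E]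
    have h3 : E' ((X : ℝ[X]) • y) = E (Ideal.Quotient.mk _ X) * E y := by
      rw [h1, ← map_mul]; rfl
    rw [h3, h2, map_add, add_mul, Algebra.smul_def]
    rfl
  refine ⟨Fin pb.dim, inferInstance, pb.basis.map E'.symm, fun i j => ?_⟩
  have hdim : pb.dim = e := by simp [pb]
  have hgen : pb.gen = AdjoinRoot.root (X ^ e : ℝ[X]) := by simp [pb]
  simp only [Module.Basis.map_apply, Module.Basis.map_repr, LinearEquiv.trans_apply,
    LinearEquiv.symm_symm, hE, LinearEquiv.apply_symm_apply, map_add, map_smul,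
    Finsupp.add_apply, Finsupp.smul_apply, smul_eq_mul, Module.Basis.repr_self]
  refine add_nonneg ?_ (mul_nonneg hd ?_)
  · rw [PowerBasis.basis_eq_pow, hgen, ← pow_succ']
    by_cases hj : (j : ℕ) + 1 < pb.dim
    · rw [← hgen, show (j : ℕ) + 1 = ((⟨j + 1, hj⟩ : Fin pb.dim) : ℕ) from rfl,
        ← pb.basis_eq_pow, Module.Basis.repr_self]
      exact Finsupp.single_nonneg.2 zero_le_one i
    · have hj' : (j : ℕ) + 1 = e := by omega
      have h0 : (AdjoinRoot.root (X ^ e : ℝ[X])) ^ e = 0 := by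
        rw [AdjoinRoot.root, ← map_pow, AdjoinRoot.mk_self]
      rw [hj', h0, map_zero]; rfl
  · exact Finsupp.single_nonneg.2 zero_le_one i

theorem of_smul_eq_zero {M : Type} [AddCommGroup M] [Module ℝ M] [Module ℝ[X] M]
    [IsScalarTower ℝ ℝ[X] M] [Module.Finite ℝ[X] M] {F : ℝ[X]} (hF0 : F ≠ 0) (hF : F.Splits)
    (hroots : ∀ d ∈ F.roots, 0 ≤ d) (h : ∀ x : M, F • x = 0) : HasNonnegBasis M := by
  classical
  obtain ⟨ι, hι, p, hp, e, ⟨E⟩⟩ := Module.equiv_directSum_of_isTorsion (R := ℝ[X]) (M := M)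
    (fun {x} => ⟨⟨F, mem_nonZeroDivisors_of_ne_zero hF0⟩, h x⟩)
  let E' : M ≃ₗ[ℝ[X]] (∀ i, ℝ[X] ⧸ Ideal.span {p i ^ e i}) :=
    E.trans (DirectSum.linearEquivFunOnFintype ℝ[X] ι _)
  refine (pi fun i => ?_).of_linearEquiv E'
  rcases Nat.eq_zero_or_pos (e i) with he | he
  · have hspan : Ideal.span {p i ^ e i} = Ideal.span {(X - C 0) ^ 0} := by
      rw [he, pow_zero, pow_zero]
    rw [hspan]
    exact quotient_X_sub_C_pow le_rfl 0
  have hdvd : p i ^ e i ∣ F := by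
    have h1 : F • E'.symm (Pi.single i (Ideal.Quotient.mk _ 1)) = 0 := h _
    rw [← map_smul, LinearEquiv.map_eq_zero_iff, ← Pi.single_smul, Pi.single_eq_zero_iff] at h1
    rw [← Ideal.mem_span_singleton, ← Ideal.Quotient.eq_zero_iff_mem, ← h1]
    change _ = Ideal.Quotient.mk _ (F * 1)
    rw [mul_one]
  have hpF : p i ∣ F := (dvd_pow_self _ he.ne').trans hdvd
  have hdeg : (p i).degree = 1 := (hF.of_dvd hF0 hpF).degree_eq_one_of_irreducible (hp i)
  obtain ⟨d, hd⟩ := exists_root_of_degree_eq_one hdeg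
  have hassoc : Associated (X - C d) (p i) :=
    (irreducible_X_sub_C d).associated_of_dvd (hp i) (dvd_iff_isRoot.2 hd)
  have hd0 : 0 ≤ d := hroots d ((mem_roots hF0).2 (hd.dvd hpF))
  have hspan : Ideal.span {(X - C d) ^ e i} = Ideal.span {p i ^ e i} :=
    Ideal.span_singleton_eq_span_singleton.2 (hassoc.pow_pow)
  rw [← hspan]
  exact quotient_X_sub_C_pow hd0 _

end Polynomial.HasNonnegBasis

theorem Matrix.exists_conj_nonneg {n : ℕ} (B : Matrix (Fin n) (Fin n) ℝ) {F : ℝ[X]} (hF0 : F ≠ 0)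
    (hF : F.Splits) (hroots : ∀ d ∈ F.roots, 0 ≤ d) (h : aeval B F = 0) :
    ∃ T T' : Matrix (Fin n) (Fin n) ℝ, T * T' = 1 ∧ ∀ i j, 0 ≤ (T * B * T') i j := by
  let f := B.toLin'
  have hf : aeval f F = 0 := by
    have := aeval_algHom_apply (Matrix.toLinAlgEquiv' (R := ℝ) (n := Fin n)) B F
    rw [h, map_zero] at this
    exact this
  obtain ⟨ι, hι, b, hb⟩ := HasNonnegBasis.of_smul_eq_zero (M := Module.AEval' f) hF0 hF hroots
    (fun x => by
      obtain ⟨v, rfl⟩ := (Module.AEval'.of f).surjective x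
      rw [← Module.AEval.of_aeval_smul, hf, zero_smul, map_zero])
  let b' : Module.Basis ι ℝ (Fin n → ℝ) := b.map (Module.AEval'.of f).symm
  have hcard : Fintype.card ι = n := by
    rw [← Module.finrank_eq_card_basis b', Module.finrank_fin_fun]
  let b'' := b'.reindex (Fintype.equivFinOfCardEq hcard)
  refine ⟨b''.toMatrix (Pi.basisFun ℝ (Fin n)), (Pi.basisFun ℝ (Fin n)).toMatrix b'',
    Module.Basis.toMatrix_mul_toMatrix_flip _ _, fun i j => ?_⟩
  have hB : B = LinearMap.toMatrix (Pi.basisFun ℝ (Fin n)) (Pi.basisFun ℝ (Fin n)) f := by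
    rw [LinearMap.toMatrix_eq_toMatrix', LinearMap.toMatrix'_toLin']
  rw [hB, basis_toMatrix_mul_linearMap_toMatrix_mul_basis_toMatrix, LinearMap.toMatrix_apply]
  have := hb ((Fintype.equivFinOfCardEq hcard).symm i) ((Fintype.equivFinOfCardEq hcard).symm j)
  simpa [b'', b', ← Module.AEval'.X_smul_of] using this

theorem Polynomial.sub_dvd_comp_sub_comp {R : Type*} [CommRing R] (p q F : R[X]) :
    p - q ∣ F.comp p - F.comp q := by
  have h := sub_dvd_eval_sub p q (F.map C)
  rwa [eval_map, eval_map] at h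

theorem Polynomial.aeval_mul_mul_of_mul_eq_one {K R : Type*} [CommRing K] [Ring R] [Algebra K R]
    {T T' : R} (h : T * T' = 1) (h' : T' * T = 1) (B : R) (F : K[X]) :
    aeval (T * B * T') F = T * aeval B F * T' := by
  let e : R →ₐ[K] R := AlgHom.ofLinearMap (LinearMap.mulLeft K T ∘ₗ LinearMap.mulRight K T')
    (by simp [h]) fun x y => by
      simp only [LinearMap.comp_apply, LinearMap.mulLeft_apply, LinearMap.mulRight_apply]
      calc T * (x * y * T') = T * x * 1 * (y * T') := by simp only [mul_assoc, one_mul]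
        _ = T * (x * T') * (T * (y * T')) := by rw [← h']; simp only [mul_assoc]
  simpa [e, mul_assoc] using aeval_algHom_apply e B F

/-- Jordan–Chevalley decomposition: `q(A)` is the semisimple part of `A`. -/
theorem Matrix.exists_aeval_separable {n : ℕ} (A : Matrix (Fin n) (Fin n) ℝ) :
    ∃ q m : ℝ[X], IsNilpotent (aeval A (X - q)) ∧ m.Separable ∧ m ∣ A.charpoly ∧
      aeval (aeval A q) m = 0 := by
  let e := Matrix.toLinAlgEquiv' (R := ℝ) (n := Fin n)
  obtain ⟨N, hN, S, hS, hnil, hss, hsum⟩ :=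
    Module.End.exists_isNilpotent_isSemisimple (K := ℝ) (f := e A)
  rw [Algebra.adjoin_singleton_eq_range_aeval] at hS
  obtain ⟨q, hq⟩ := hS
  replace hq : aeval (e A) q = S := hq
  have hS' : e (aeval A q) = S := by rw [← hq]; exact (aeval_algHom_apply e A q).symm
  have hN' : e (aeval A (X - q)) = N := by
    rw [map_sub, map_sub, hS', aeval_X, hsum, add_sub_cancel_right]
  have hnilA : IsNilpotent (aeval A (X - q)) := by
    rwa [← hN', IsNilpotent.map_iff e.injective] at hnil
  refine ⟨q, minpoly ℝ S, hnilA, ?_, ?_, ?_⟩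
  · exact PerfectField.separable_iff_squarefree.2 hss.minpoly_squarefree
  · obtain ⟨k, hk⟩ := hnilA
    have hdvd : X - q ∣ A.charpoly - A.charpoly.comp q := by
      simpa only [comp_X] using sub_dvd_comp_sub_comp X q A.charpoly
    obtain ⟨c, hc⟩ := hdvd
    have h1 : aeval (aeval A q) (A.charpoly ^ (k + 1)) = 0 := by
      have h2 : aeval (aeval A q) A.charpoly = - aeval A ((X - q) * c) := by
        rw [← hc, map_sub, aeval_self_charpoly, aeval_comp]; simp
      rw [map_pow, h2, ← map_neg, ← map_pow, ← mul_neg, mul_pow, map_mul, pow_succ, map_mul,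
        map_pow, hk]
      simp
    have h3 : minpoly ℝ S ∣ A.charpoly ^ (k + 1) := by
      refine minpoly.dvd _ _ ?_
      rw [← hS']
      exact (aeval_algHom_apply e _ _).trans (by rw [h1]; exact map_zero e)
    exact (hss.minpoly_squarefree.dvd_pow_iff_dvd k.succ_ne_zero).1 h3
  · apply e.injective
    rw [map_zero, ← minpoly.aeval ℝ S, ← hS']
    exact (aeval_algHom_apply e _ _).symm

theorem Polynomial.isNilpotent_aeval_aeval_of_sub {R : Type*} [Ring R] [Algebra ℝ R] {A : R}
    {p q F : ℝ[X]} (h : IsNilpotent (aeval A (p - q))) (hq : aeval (aeval A q) F = 0) :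
    IsNilpotent (aeval (aeval A p) F) := by
  obtain ⟨c, hc⟩ := sub_dvd_comp_sub_comp p q F
  have h1 : aeval (aeval A p) F = aeval A (p - q) * aeval A c := by
    rw [← map_mul, ← hc, map_sub, aeval_comp, aeval_comp, hq, sub_zero]
  rw [h1]
  exact (Commute.isNilpotent_mul_right (Commute.all (p - q) c |>.map (aeval A)) h)

theorem IsSchur.of_aeval_eq_zero {n : ℕ} {N : Matrix (Fin n) (Fin n) ℝ} {F : ℝ[X]}
    (hF : aeval N F = 0) (h : ∀ z : ℂ, aeval z F = 0 → ‖z‖ < 1) : IsSchur N := by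
  intro μ hμ
  refine h μ ?_
  have h1 : aeval (N.map (algebraMap ℝ ℂ)) (F.map (algebraMap ℝ ℂ)) = 0 := by
    rw [← Matrix.map_algebraMap_aeval, hF]; simp
  have : Nontrivial (Matrix (Fin n) (Fin n) ℂ) := by
    by_contra hn
    rw [not_nontrivial_iff_subsingleton] at hn
    simp [spectrum.of_subsingleton] at hμ
  have h2 := spectrum.subset_polynomial_aeval (N.map (algebraMap ℝ ℂ)) (F.map (algebraMap ℝ ℂ))
    ⟨μ, hμ, rfl⟩
  rw [h1, spectrum.zero_eq] at h2
  simpa [eval_map_algebraMap] using h2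

/-- The elliptic part `U(A)` of `A` is invertible with inverse `V(A)`, its powers are bounded, and
the eigenvalues of `V(A) * A` are the moduli of those of `A`. -/
theorem IsSchur.exists_bounded_aeval {n : ℕ} {A : Matrix (Fin n) (Fin n) ℝ} (hA : IsSchur A) :
    ∃ (U V : ℝ[X]) (F : ℝ[X]) (c : ℝ), aeval A U * aeval A V = 1 ∧
      (∀ k : ℕ, ‖aeval A U ^ k‖ ≤ c) ∧ (∀ k : ℕ, ‖aeval A V ^ k‖ ≤ c) ∧ F ≠ 0 ∧ F.Splits ∧
      (∀ d ∈ F.roots, 0 ≤ d) ∧ (∀ z : ℂ, aeval z F = 0 → ‖z‖ < 1) ∧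
      aeval (aeval A (V * X)) F = 0 := by
  obtain ⟨q, m, hnil, hsep, hdvd, hm⟩ := A.exists_aeval_separable
  set Λ := (m.aroots ℂ).toFinset with hΛ
  have memΛ : ∀ {z : ℂ}, z ∈ Λ ↔ aeval z m = 0 := fun {z} => by
    rw [hΛ, Multiset.mem_toFinset, mem_aroots, and_iff_right hsep.ne_zero]
  have hconj : ∀ z ∈ Λ, starRingEnd ℂ z ∈ Λ := fun z hz => by
    rw [memΛ] at hz ⊢
    rw [aeval_conj, hz, map_zero]
  have hlt : ∀ z ∈ Λ, ‖z‖ < 1 := fun z hz => by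
    refine hA z ?_
    obtain ⟨r, hr⟩ := hdvd
    rw [Matrix.mem_spectrum_iff_isRoot_charpoly, Matrix.charpoly_map, IsRoot, eval_map_algebraMap,
      hr, map_mul, memΛ.1 hz, zero_mul]
  let u : ℂ → ℂ := fun z => if z = 0 then 1 else z / ‖z‖
  have hu : ∀ z, u (starRingEnd ℂ z) = starRingEnd ℂ (u z) := fun z => by
    by_cases hz : z = 0 <;> simp [u, hz]
  have hnorm : ∀ z, ‖u z‖ = 1 := fun z => by
    by_cases hz : z = 0 <;> simp [u, hz]
  have huz : ∀ z, starRingEnd ℂ (u z) * z = ‖z‖ := fun z => by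
    by_cases hz : z = 0
    · simp [hz]
    · have : (‖z‖ : ℂ) ≠ 0 := by simpa using hz
      simp only [u, if_neg hz, map_div₀, Complex.conj_ofReal]
      rw [div_mul_eq_mul_div, Complex.conj_mul', pow_two, mul_div_assoc, div_self this, mul_one]
  obtain ⟨U, hU⟩ := Λ.exists_real_polynomial_aeval_eq hconj u hu
  obtain ⟨V, hV⟩ := Λ.exists_real_polynomial_aeval_eq hconj (fun z => starRingEnd ℂ (u z))
    fun z => by rw [hu]
  obtain ⟨c, hc⟩ := hsep.exists_norm_aeval_pow_le hm (p := U) fun z hz => by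
    rw [hU z (Multiset.mem_toFinset.2 hz), hnorm]
  obtain ⟨c', hc'⟩ := hsep.exists_norm_aeval_pow_le hm (p := V) fun z hz => by
    rw [hV z (Multiset.mem_toFinset.2 hz), RCLike.norm_conj, hnorm]
  set F₀ : ℝ[X] := ∏ z ∈ Λ, (X - C ‖z‖) with hF₀
  have hF₀0 : F₀ ≠ 0 := (monic_prod_X_sub_C _ _).ne_zero
  have hF : aeval (aeval A (V.comp q * q)) F₀ = 0 := by
    have h1 : aeval (aeval A q) (F₀.comp (V * X)) = aeval (aeval A q) (0 : ℝ[X]) := by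
      refine hsep.aeval_eq_of_aroots hm fun z hz => ?_
      have hz' : z ∈ Λ := Multiset.mem_toFinset.2 hz
      rw [aeval_comp, map_mul, hV z hz', aeval_X, huz, map_zero, hF₀, map_prod]
      exact Finset.prod_eq_zero hz' (by simp)
    rw [map_zero, aeval_comp, map_mul, aeval_X] at h1
    rwa [map_mul, aeval_comp]
  obtain ⟨k, hk⟩ : IsNilpotent (aeval (aeval A (V.comp q * X)) F₀) := by
    refine isNilpotent_aeval_aeval_of_sub ?_ hF
    rw [← mul_sub, map_mul (aeval A)]
    exact Commute.isNilpotent_mul_left ((Commute.all (V.comp q) (X - q)).map (aeval A)) hnil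
  have hroot : ∀ {R : Type} [CommRing R] [IsDomain R] [Algebra ℝ R] {x : R},
      aeval x (F₀ ^ k) = 0 → ∃ z ∈ Λ, x = algebraMap ℝ R ‖z‖ := fun {R} _ _ _ {x} hx => by
    rw [map_pow] at hx
    have := eq_zero_of_pow_eq_zero hx
    rw [hF₀, map_prod, Finset.prod_eq_zero_iff] at this
    obtain ⟨z, hz, h0⟩ := this
    exact ⟨z, hz, by simpa [sub_eq_zero] using h0⟩
  refine ⟨U.comp q, V.comp q, F₀ ^ k, max c c', ?_, fun k => ?_, fun k => ?_, pow_ne_zero _ hF₀0,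
    (Splits.prod fun z _ => Splits.X_sub_C _).pow _, fun d hd => ?_, fun z hz => ?_, ?_⟩
  · rw [aeval_comp, aeval_comp, ← map_mul, ← map_one (aeval (R := ℝ) (aeval A q))]
    refine hsep.aeval_eq_of_aroots hm fun z hz => ?_
    have hz' : z ∈ Λ := Multiset.mem_toFinset.2 hz
    rw [map_mul, hU z hz', hV z hz', Complex.mul_conj', hnorm]
    simp
  · rw [aeval_comp]
    exact (hc k).trans (le_max_left _ _)
  · rw [aeval_comp]
    exact (hc' k).trans (le_max_right _ _)
  · obtain ⟨z, -, rfl⟩ := hroot (x := d) (by simpa using (mem_roots'.1 hd).2)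
    exact norm_nonneg z
  · obtain ⟨w, hw, rfl⟩ := hroot hz
    simpa using hlt w hw
  · rw [map_pow, hk]

end

/-- for any Schur matrix `A` there exist a sequence of invertible matrices
`(R_k)`, a scalar `σ > 0` and a constant entrywise-nonnegative Schur matrix `N` such that
for all `k`, `‖R_k‖ + ‖R_k⁻¹‖ ≤ σ` and `R_{k+1} A R_k⁻¹ = N`. -/
theorem stmt1 {n : ℕ} (A : Matrix (Fin n) (Fin n) ℝ) (hA : IsSchur A) :
    ∃ (R : ℕ → Matrix (Fin n) (Fin n) ℝ) (σ : ℝ) (N : Matrix (Fin n) (Fin n) ℝ),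
      0 < σ ∧ (∀ i j, 0 ≤ N i j) ∧ IsSchur N ∧
      ∀ k : ℕ, IsUnit (R k).det ∧ ‖R k‖ + ‖(R k)⁻¹‖ ≤ σ ∧
        R (k + 1) * A * (R k)⁻¹ = N := by
  obtain ⟨U, V, F, c, hUV, hU, hV, hF0, hF, hroots, hlt, hB⟩ := hA.exists_bounded_aeval
  obtain ⟨T, T', hT, hN⟩ := Matrix.exists_conj_nonneg _ hF0 hF hroots hB
  have hVU : Polynomial.aeval A V * Polynomial.aeval A U = 1 := mul_eq_one_comm.1 hUV
  have hT' : T' * T = 1 := mul_eq_one_comm.1 hT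
  have hpow : ∀ k, Polynomial.aeval A V ^ k * Polynomial.aeval A U ^ k = 1 := fun k => by
    rw [← map_pow, ← map_pow, ← map_mul, ← mul_pow, map_pow, map_mul, hVU, one_pow]
  have hR : ∀ k, T * Polynomial.aeval A V ^ k * (Polynomial.aeval A U ^ k * T') = 1 := fun k => by
    rw [mul_assoc, ← mul_assoc (_ ^ k), hpow, one_mul, hT]
  have hinv : ∀ k, (T * Polynomial.aeval A V ^ k)⁻¹ = Polynomial.aeval A U ^ k * T' :=
    fun k => Matrix.inv_eq_right_inv (hR k)
  have hc : 0 ≤ c := (norm_nonneg _).trans (hU 0)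
  refine ⟨fun k => T * Polynomial.aeval A V ^ k, ‖T‖ * c + c * ‖T'‖ + 1,
    T * Polynomial.aeval A (V * Polynomial.X) * T', by positivity, hN,
    IsSchur.of_aeval_eq_zero ?_ hlt, fun k => ⟨?_, ?_, ?_⟩⟩
  · rw [Polynomial.aeval_mul_mul_of_mul_eq_one hT hT', hB, mul_zero, zero_mul]
  · exact Matrix.isUnit_det_of_right_inverse (hR k)
  · rw [hinv]
    have h1 := (Matrix.linfty_opNorm_mul T (Polynomial.aeval A V ^ k)).trans
      (mul_le_mul_of_nonneg_left (hV k) (norm_nonneg T))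
    have h2 := (Matrix.linfty_opNorm_mul (Polynomial.aeval A U ^ k) T').trans
      (mul_le_mul_of_nonneg_right (hU k) (norm_nonneg T'))
    linarith
  · have h : Polynomial.aeval A V ^ (k + 1) * A * Polynomial.aeval A U ^ k
        = Polynomial.aeval A (V * Polynomial.X) := by
      have hcomm : Commute A (Polynomial.aeval A U ^ k) := by
        simpa using (Commute.all Polynomial.X (U ^ k)).map (Polynomial.aeval A)
      rw [mul_assoc, hcomm.eq, pow_succ', ← mul_assoc, mul_assoc _ _ (_ ^ k), hpow, mul_one,
        map_mul, Polynomial.aeval_X]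
    simp only [hinv]
    rw [← h]
    simp only [mul_assoc]
end

section
/- Let f : ℝ^{n_x} → ℝ^{n_x} be a bijection whose inverse f⁻¹ is globally Lipschitz with constant c_f > 0, let h : ℝ^{n_x} → ℝ^{n_y} be globally Lipschitz with constant c_h > 0, and let A ∈ ℝ^{n_z×n_z}, B ∈ ℝ^{n_z×n_y} satisfy ‖A‖ < 1 and ‖A‖·c_f < 1. Then for every x ∈ ℝ^{n_x} the series T(x) = Σ_{i=0}^{∞} Aⁱ B h((f⁻¹)^{∘(i+1)}(x)) converges absolutely, and the resulting map T : ℝ^{n_x} → ℝ^{n_z} satisfies the discrete Sylvester-type functional equation T(f(x)) = A T(x) + B h(x) for all x ∈ ℝ^{n_x}. -/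
open Matrix

attribute [local instance] Matrix.linftyOpNormedAddCommGroup

theorem norm_pow_mulVec_le {n : ℕ} (A : Matrix (Fin n) (Fin n) ℝ) (v : Fin n → ℝ) (i : ℕ) :
    ‖(A ^ i) *ᵥ v‖ ≤ ‖A‖ ^ i * ‖v‖ := by
  induction i with
  | zero => simp
  | succ k ih =>
    rw [pow_succ', ← mulVec_mulVec, pow_succ', mul_assoc]
    exact (linfty_opNorm_mulVec A _).trans (mul_le_mul_of_nonneg_left ih (norm_nonneg A))

/-- The orbit of a point under a map satisfying a Lipschitz bound grows at most like `i * M ^ i`. -/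
theorem norm_iterate_sub_le {E : Type*} [SeminormedAddCommGroup E] {g : E → E} {c M : ℝ}
    (hcM : c ≤ M) (hM : 1 ≤ M) (hg : ∀ xa xb, ‖g xa - g xb‖ ≤ c * ‖xa - xb‖) (x : E) (i : ℕ) :
    ‖g^[i] x - x‖ ≤ ‖g x - x‖ * (i * M ^ i) := by
  induction i with
  | zero => simp
  | succ k ih =>
    rw [Function.iterate_succ_apply']
    have hpow : 1 ≤ M ^ (k + 1) := one_le_pow₀ hM
    calc ‖g (g^[k] x) - x‖ ≤ ‖g (g^[k] x) - g x‖ + ‖g x - x‖ := norm_sub_le_norm_sub_add_norm_sub ..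
      _ ≤ M * (‖g x - x‖ * (k * M ^ k)) + ‖g x - x‖ * M ^ (k + 1) := by
        refine add_le_add ?_ (le_mul_of_one_le_right (norm_nonneg _) hpow)
        exact (hg _ _).trans (mul_le_mul hcM ih (norm_nonneg _) (by linarith))
      _ = ‖g x - x‖ * ((k + 1 : ℕ) * M ^ (k + 1)) := by push_cast; ring

theorem summable_norm_pow_mulVec_iterate {nx ny nz : ℕ} {g : (Fin nx → ℝ) → (Fin nx → ℝ)}
    {h : (Fin nx → ℝ) → (Fin ny → ℝ)} {cf ch : ℝ} (hch : 0 ≤ ch)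
    (hg : ∀ xa xb, ‖g xa - g xb‖ ≤ cf * ‖xa - xb‖)
    (hh : ∀ xa xb, ‖h xa - h xb‖ ≤ ch * ‖xa - xb‖)
    {A : Matrix (Fin nz) (Fin nz) ℝ} (B : Matrix (Fin nz) (Fin ny) ℝ)
    (hA : ‖A‖ < 1) (hAcf : ‖A‖ * cf < 1) (x : Fin nx → ℝ) :
    Summable fun i : ℕ => ‖(A ^ i) *ᵥ (B *ᵥ h (g^[i + 1] x))‖ := by
  set M := max 1 cf
  have hr : ‖‖A‖ * M‖ < 1 := by
    rw [Real.norm_of_nonneg (by positivity), mul_max_of_nonneg _ _ (norm_nonneg A), mul_one]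
    exact max_lt hA hAcf
  have hgeom : Summable fun i : ℕ => (i : ℝ) * (‖A‖ * M) ^ i := by
    simpa using summable_pow_mul_geometric_of_norm_lt_one 1 hr
  have hA' : Summable fun i : ℕ => ‖A‖ ^ i := summable_geometric_of_lt_one (norm_nonneg A) hA
  refine Summable.of_nonneg_of_le (fun _ => norm_nonneg _) (fun i => ?_)
    ((hA'.mul_left (‖B‖ * ‖h (g x)‖)).add
      (hgeom.mul_left (‖B‖ * (ch * ‖g (g x) - g x‖))))
  have hB : ‖h (g^[i + 1] x)‖ ≤ ‖h (g x)‖ + ch * (‖g (g x) - g x‖ * (i * M ^ i)) := by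
    rw [Function.iterate_succ_apply]
    have hd := (hh (g^[i] (g x)) (g x)).trans (mul_le_mul_of_nonneg_left
      (norm_iterate_sub_le (le_max_right 1 cf) (le_max_left 1 cf) hg (g x) i) hch)
    linarith [norm_le_norm_add_norm_sub (h (g x)) (h (g^[i] (g x))),
      norm_sub_rev (h (g x)) (h (g^[i] (g x)))]
  calc _ ≤ ‖A‖ ^ i * ‖B *ᵥ h (g^[i + 1] x)‖ := norm_pow_mulVec_le ..
    _ ≤ ‖A‖ ^ i * (‖B‖ * (‖h (g x)‖ + ch * (‖g (g x) - g x‖ * (i * M ^ i)))) := by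
      gcongr
      exact (linfty_opNorm_mulVec B _).trans (mul_le_mul_of_nonneg_left hB (norm_nonneg B))
    _ = _ := by rw [mul_pow]; ring

/-- under the Lipschitz assumptions on `f⁻¹` (called `g`) and `h`, and
`‖A‖ < 1`, `‖A‖ c_f < 1`, the series defining `T` converges absolutely at every point,
and `T` satisfies the Sylvester-type equation `T(f(x)) = A T(x) + B h(x)`. -/
theorem stmt2 {nx ny nz : ℕ}
    (f g : (Fin nx → ℝ) → (Fin nx → ℝ))
    (hfg : Function.LeftInverse g f) (hgf : Function.RightInverse g f)
    (h : (Fin nx → ℝ) → (Fin ny → ℝ))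
    (cf ch : ℝ) (hcf : 0 < cf) (hch : 0 < ch)
    (hg : ∀ xa xb, ‖g xa - g xb‖ ≤ cf * ‖xa - xb‖)
    (hh : ∀ xa xb, ‖h xa - h xb‖ ≤ ch * ‖xa - xb‖)
    (A : Matrix (Fin nz) (Fin nz) ℝ) (B : Matrix (Fin nz) (Fin ny) ℝ)
    (hA : ‖A‖ < 1) (hAcf : ‖A‖ * cf < 1) :
    (∀ x, Summable fun i : ℕ => ‖(A ^ i) *ᵥ (B *ᵥ h (g^[i + 1] x))‖) ∧
    (∀ x, (∑' i : ℕ, (A ^ i) *ᵥ (B *ᵥ h (g^[i + 1] (f x))))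
        = A *ᵥ (∑' i : ℕ, (A ^ i) *ᵥ (B *ᵥ h (g^[i + 1] x))) + B *ᵥ h x) := by
  have hsum := summable_norm_pow_mulVec_iterate hch.le hg hh B hA hAcf
  refine ⟨hsum, fun x => ?_⟩
  rw [(hsum (f x)).of_norm.tsum_eq_zero_add, add_comm]
  congr 1
  · have hmap := (hsum x).of_norm.map_tsum A.mulVecLin
      (LinearMap.continuous_of_finiteDimensional _)
    simp only [mulVecLin_apply] at hmap
    rw [hmap]
    refine tsum_congr fun i => ?_
    rw [Function.iterate_succ_apply, hfg x, pow_succ', ← mulVec_mulVec]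
  · simp [hfg x]
end

section
/- Let f : ℝ^{n_x} → ℝ^{n_x} be a bijection whose inverse f⁻¹ is globally Lipschitz with constant c_f > 0, let h : ℝ^{n_x} → ℝ^{n_y} be globally Lipschitz with constant c_h > 0, and let A ∈ ℝ^{n_z×n_z}, B ∈ ℝ^{n_z×n_y} satisfy ‖A‖ < 1 and ‖A‖·c_f < 1. Then the map T(x) = Σ_{i=0}^{∞} Aⁱ B h((f⁻¹)^{∘(i+1)}(x)) is globally Lipschitz on ℝ^{n_x} with constant c_L = ‖B‖·c_h·c_f / (1 − ‖A‖·c_f), i.e., ‖T(x_a) − T(x_b)‖ ≤ c_L ‖x_a − x_b‖ for all x_a, x_b ∈ ℝ^{n_x}. -/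
open Matrix

attribute [local instance] Matrix.linftyOpNormedAddCommGroup

theorem Matrix.linfty_opNorm_pow_mulVec_le {n : Type*} [Fintype n] [DecidableEq n]
    (A : Matrix n n ℝ) (v : n → ℝ) (i : ℕ) : ‖(A ^ i) *ᵥ v‖ ≤ ‖A‖ ^ i * ‖v‖ := by
  induction i with
  | zero => simp
  | succ k ih =>
    rw [pow_succ', ← mulVec_mulVec]
    calc ‖A *ᵥ (A ^ k *ᵥ v)‖ ≤ ‖A‖ * ‖A ^ k *ᵥ v‖ := linfty_opNorm_mulVec _ _
      _ ≤ ‖A‖ * (‖A‖ ^ k * ‖v‖) := by gcongr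
      _ = ‖A‖ ^ (k + 1) * ‖v‖ := by ring

theorem norm_iterate_sub_iterate_le {E : Type*} [SeminormedAddCommGroup E] {g : E → E} {c : ℝ}
    (hc : 0 ≤ c) (hg : ∀ x y, ‖g x - g y‖ ≤ c * ‖x - y‖) (x y : E) (i : ℕ) :
    ‖g^[i] x - g^[i] y‖ ≤ c ^ i * ‖x - y‖ := by
  induction i with
  | zero => simp
  | succ k ih =>
    rw [Function.iterate_succ_apply', Function.iterate_succ_apply']
    calc ‖g (g^[k] x) - g (g^[k] y)‖ ≤ c * ‖g^[k] x - g^[k] y‖ := hg _ _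
      _ ≤ c * (c ^ k * ‖x - y‖) := by gcongr
      _ = c ^ (k + 1) * ‖x - y‖ := by ring

/-- No summability of `u` or `v` is needed: if their difference is summable, then either both are
summable or both sums take the default value `0`. -/
theorem norm_tsum_sub_tsum_le {E : Type*} [NormedAddCommGroup E] [CompleteSpace E]
    {u v : ℕ → E} {b : ℕ → ℝ} {s : ℝ} (hb : HasSum b s) (huv : ∀ i, ‖u i - v i‖ ≤ b i) :
    ‖∑' i, u i - ∑' i, v i‖ ≤ s := by
  have hd : Summable fun i => u i - v i := Summable.of_norm_bounded hb.summable huv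
  by_cases hv : Summable v
  · have hu : Summable u := by simpa using hd.add hv
    rw [← hu.tsum_sub hv]
    exact tsum_of_norm_bounded hb huv
  · have hu : ¬ Summable u := fun hu => hv (by simpa using hu.sub hd)
    rw [tsum_eq_zero_of_not_summable hu, tsum_eq_zero_of_not_summable hv]
    simpa using hb.nonneg fun i => (norm_nonneg _).trans (huv i)

/-- the KKL transformation
`T(x) = Σ_{i=0}^∞ Aⁱ B h((f⁻¹)^{∘(i+1)}(x))` is globally Lipschitz with constant
`c_L = ‖B‖ c_h c_f / (1 − ‖A‖ c_f)`. -/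
theorem stmt3 {nx ny nz : ℕ}
    (f g : (Fin nx → ℝ) → (Fin nx → ℝ))
    (hfg : Function.LeftInverse g f) (hgf : Function.RightInverse g f)
    (h : (Fin nx → ℝ) → (Fin ny → ℝ))
    (cf ch : ℝ) (hcf : 0 < cf) (hch : 0 < ch)
    (hg : ∀ xa xb, ‖g xa - g xb‖ ≤ cf * ‖xa - xb‖)
    (hh : ∀ xa xb, ‖h xa - h xb‖ ≤ ch * ‖xa - xb‖)
    (A : Matrix (Fin nz) (Fin nz) ℝ) (B : Matrix (Fin nz) (Fin ny) ℝ)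
    (hA : ‖A‖ < 1) (hAcf : ‖A‖ * cf < 1) :
    ∀ xa xb,
      ‖(∑' i : ℕ, (A ^ i) *ᵥ (B *ᵥ h (g^[i + 1] xa)))
          - (∑' i : ℕ, (A ^ i) *ᵥ (B *ᵥ h (g^[i + 1] xb)))‖
        ≤ (‖B‖ * ch * cf / (1 - ‖A‖ * cf)) * ‖xa - xb‖ := by
  intro xa xb
  have hs : HasSum (fun i : ℕ => (‖B‖ * ch * cf) * (‖A‖ * cf) ^ i * ‖xa - xb‖)
      (‖B‖ * ch * cf / (1 - ‖A‖ * cf) * ‖xa - xb‖) := by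
    rw [div_eq_mul_inv]
    exact ((hasSum_geometric_of_lt_one (by positivity) hAcf).mul_left _).mul_right _
  refine norm_tsum_sub_tsum_le hs fun i => ?_
  rw [← mulVec_sub, ← mulVec_sub]
  calc ‖A ^ i *ᵥ (B *ᵥ (h (g^[i + 1] xa) - h (g^[i + 1] xb)))‖
      ≤ ‖A‖ ^ i * ‖B *ᵥ (h (g^[i + 1] xa) - h (g^[i + 1] xb))‖ :=
        linfty_opNorm_pow_mulVec_le _ _ _
    _ ≤ ‖A‖ ^ i * (‖B‖ * ‖h (g^[i + 1] xa) - h (g^[i + 1] xb)‖) := by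
        gcongr
        exact linfty_opNorm_mulVec _ _
    _ ≤ ‖A‖ ^ i * (‖B‖ * (ch * (cf ^ (i + 1) * ‖xa - xb‖))) := by
        gcongr
        exact (hh _ _).trans
          (mul_le_mul_of_nonneg_left (norm_iterate_sub_iterate_le hcf.le hg _ _ _) hch.le)
    _ = ‖B‖ * ch * cf * (‖A‖ * cf) ^ i * ‖xa - xb‖ := by ring
end

section
/- Let X ⊆ ℝ^{n_x} and let T : X → ℝ^{n_z} be Lipschitz injective on X with constant α > 0, i.e., ‖T(x_a) − T(x_b)‖ ≥ α ‖x_a − x_b‖ for all x_a, x_b ∈ X. Then there exist a constant c > 0 (depending only on the dimensions and the chosen norms, not on T or α) and a map T* : ℝ^{n_z} → ℝ^{n_x} such that T*(T(x)) = x for all x ∈ X, and T* is globally Lipschitz with constant c/α: ‖T*(z_a) − T*(z_b)‖ ≤ (c/α) ‖z_a − z_b‖ for all z_a, z_b ∈ ℝ^{n_z}. -/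
/-- there is a constant `c > 0`, depending only on the dimensions and the
chosen (∞-)norms, such that any map `T` that is Lipschitz injective on a set `X` with
constant `α > 0` admits a global left inverse `T*` which is globally Lipschitz with
constant `c / α`. -/
theorem stmt5 {nx nz : ℕ} :
    ∃ c : ℝ, 0 < c ∧
      ∀ (X : Set (Fin nx → ℝ)) (T : (Fin nx → ℝ) → (Fin nz → ℝ)) (α : ℝ),
        0 < α →
        (∀ xa ∈ X, ∀ xb ∈ X, α * ‖xa - xb‖ ≤ ‖T xa - T xb‖) →
        ∃ Ts : (Fin nz → ℝ) → (Fin nx → ℝ),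
          (∀ x ∈ X, Ts (T x) = x) ∧
          ∀ za zb, ‖Ts za - Ts zb‖ ≤ (c / α) * ‖za - zb‖ := by
  refine ⟨1, one_pos, fun X T α hα hT => ?_⟩
  have hinj : Set.InjOn T X := fun a ha b hb hab => by
    have h := hT a ha b hb
    rw [hab, sub_self, norm_zero] at h
    exact sub_eq_zero.1 (norm_le_zero_iff.1 (nonpos_of_mul_nonpos_right h hα))
  have hlip : LipschitzOnWith (Real.toNNReal (1 / α)) (Function.invFunOn T X) (T '' X) := by
    refine LipschitzOnWith.of_dist_le_mul ?_
    rintro _ ⟨a, ha, rfl⟩ _ ⟨b, hb, rfl⟩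
    rw [hinj.leftInvOn_invFunOn ha, hinj.leftInvOn_invFunOn hb, dist_eq_norm, dist_eq_norm,
      Real.coe_toNNReal _ (by positivity), one_div, ← div_eq_inv_mul, le_div_iff₀' hα]
    exact hT a ha b hb
  obtain ⟨g, hg, hgX⟩ := hlip.extend_pi
  refine ⟨g, fun x hx => ?_, fun za zb => ?_⟩
  · rw [← hgX (Set.mem_image_of_mem T hx), hinj.leftInvOn_invFunOn hx]
  · have h := hg.dist_le_mul za zb
    rwa [dist_eq_norm, dist_eq_norm, Real.coe_toNNReal _ (by positivity)] at h
end

section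
/- Let T : ℝ^{n_x} → ℝ^{n_z} be globally Lipschitz with constant c_L > 0 with respect to the ∞-norms, and let x₀, x₀⁻, x₀⁺ ∈ ℝ^{n_x} satisfy x₀⁻ ≤ x₀ ≤ x₀⁺ componentwise. Define, for each i ∈ {1,…,n_z}, z₀,ᵢ⁺ = min{T(x₀⁺)_i, T(x₀⁻)_i} + c_L · max_{j}(x₀,ⱼ⁺ − x₀,ⱼ⁻) and z₀,ᵢ⁻ = max{T(x₀⁺)_i, T(x₀⁻)_i} − c_L · max_{j}(x₀,ⱼ⁺ − x₀,ⱼ⁻). Then z₀⁻ ≤ T(x₀) ≤ z₀⁺ componentwise. -/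
/-- with `T` globally Lipschitz with constant `c_L` for the ∞-norms and
`x₀⁻ ≤ x₀ ≤ x₀⁺`, the vectors `z₀⁺`, `z₀⁻` defined componentwise by
`z₀ᵢ⁺ = min{T(x₀⁺)ᵢ, T(x₀⁻)ᵢ} + c_L maxⱼ(x₀ⱼ⁺ − x₀ⱼ⁻)` and
`z₀ᵢ⁻ = max{T(x₀⁺)ᵢ, T(x₀⁻)ᵢ} − c_L maxⱼ(x₀ⱼ⁺ − x₀ⱼ⁻)` satisfy
`z₀⁻ ≤ T(x₀) ≤ z₀⁺` componentwise. -/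
theorem stmt8 {nx nz : ℕ} (hnx : 0 < nx)
    (T : (Fin nx → ℝ) → (Fin nz → ℝ)) (cL : ℝ) (hcL : 0 < cL)
    (hT : ∀ xa xb, ‖T xa - T xb‖ ≤ cL * ‖xa - xb‖)
    (x0 x0m x0p : Fin nx → ℝ) (h₁ : x0m ≤ x0) (h₂ : x0 ≤ x0p)
    (z0p z0m : Fin nz → ℝ)
    (hz0p : ∀ i, z0p i = min (T x0p i) (T x0m i) + cL * ⨆ j, (x0p j - x0m j))
    (hz0m : ∀ i, z0m i = max (T x0p i) (T x0m i) - cL * ⨆ j, (x0p j - x0m j)) :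
    z0m ≤ T x0 ∧ T x0 ≤ z0p := by
  set M := ⨆ j, (x0p j - x0m j)
  have hle : ∀ j, x0p j - x0m j ≤ M := fun j =>
    le_ciSup (f := fun j => x0p j - x0m j) (Set.finite_range _).bddAbove j
  have hM0 : 0 ≤ M := by
    have h := hle ⟨0, hnx⟩
    have := h₁ ⟨0, hnx⟩
    have := h₂ ⟨0, hnx⟩
    linarith
  have hp : ‖T x0 - T x0p‖ ≤ cL * M := by
    refine (hT _ _).trans (mul_le_mul_of_nonneg_left ?_ hcL.le)
    refine (pi_norm_le_iff_of_nonneg hM0).2 fun j => ?_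
    have := hle j
    have := h₁ j
    have := h₂ j
    rw [Pi.sub_apply, Real.norm_eq_abs, abs_le]
    constructor <;> linarith
  have hm : ‖T x0 - T x0m‖ ≤ cL * M := by
    refine (hT _ _).trans (mul_le_mul_of_nonneg_left ?_ hcL.le)
    refine (pi_norm_le_iff_of_nonneg hM0).2 fun j => ?_
    have := hle j
    have := h₁ j
    have := h₂ j
    rw [Pi.sub_apply, Real.norm_eq_abs, abs_le]
    constructor <;> linarith
  have hbound : ∀ i, |T x0 i - T x0p i| ≤ cL * M ∧ |T x0 i - T x0m i| ≤ cL * M := fun i =>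
    ⟨(norm_le_pi_norm (T x0 - T x0p) i).trans hp, (norm_le_pi_norm (T x0 - T x0m) i).trans hm⟩
  refine ⟨fun i => ?_, fun i => ?_⟩ <;> obtain ⟨hip, him⟩ := hbound i <;> rw [abs_le] at hip him
  · rw [hz0m, sub_le_iff_le_add]
    exact max_le (by linarith) (by linarith)
  · rw [hz0p, ← sub_le_iff_le_add]
    exact le_min (by linarith) (by linarith)
end

section
/- Let A ∈ ℝ^{n_z×n_z}, B ∈ ℝ^{n_z×n_y}, let (R_k)_{k∈ℕ} be a sequence of invertible matrices in ℝ^{n_z×n_z} such that R_{k+1} A R_k⁻¹ is entrywise nonnegative for all k, let (y_k)_{k∈ℕ} be any sequence in ℝ^{n_y}, and let (w_k, w_k⁻, w_k⁺)_{k∈ℕ} satisfy w_k⁻ ≤ w_k ≤ w_k⁺ componentwise for all k. Consider the sequences defined by z_{k+1} = A z_k + B y_k − B w_k, ẑ_{k+1}⁺ = R_{k+1}AR_k⁻¹ ẑ_k⁺ + R_{k+1}B y_k + (R_{k+1}B)^⊖ w_k⁺ − (R_{k+1}B)^⊕ w_k⁻, and ẑ_{k+1}⁻ = R_{k+1}AR_k⁻¹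 ẑ_k⁻ + R_{k+1}B y_k + (R_{k+1}B)^⊖ w_k⁻ − (R_{k+1}B)^⊕ w_k⁺. If ẑ₀⁻ ≤ R₀ z₀ ≤ ẑ₀⁺ componentwise, then for all k ∈ ℕ: ẑ_k⁻ ≤ R_k z_k ≤ ẑ_k⁺ componentwise, and consequently, with S_k = R_k⁻¹, the vectors z_k⁻ := S_k^⊕ ẑ_k⁻ − S_k^⊖ ẑ_k⁺ and z_k⁺ := S_k^⊕ ẑ_k⁺ − S_k^⊖ ẑ_k⁻ satisfy z_k⁻ ≤ z_k ≤ z_k⁺ componentwise for all k ∈ ℕ. -/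
open Matrix

/-- `M⁺`: the matrix whose entries are `max 0 (M i j)`. -/
noncomputable def matPos {m n : ℕ} (M : Matrix (Fin m) (Fin n) ℝ) : Matrix (Fin m) (Fin n) ℝ :=
  Matrix.of fun i j => max 0 (M i j)

/-- `M⁻ := M⁺ - M`. -/
noncomputable def matNeg {m n : ℕ} (M : Matrix (Fin m) (Fin n) ℝ) : Matrix (Fin m) (Fin n) ℝ :=
  matPos M - M

theorem mulVec_le_mulVec_of_nonneg {m n : ℕ} {M : Matrix (Fin m) (Fin n) ℝ}
    (hM : ∀ i j, 0 ≤ M i j) {u v : Fin n → ℝ} (huv : u ≤ v) : M *ᵥ u ≤ M *ᵥ v := by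
  intro i
  simp only [Matrix.mulVec, dotProduct]
  exact Finset.sum_le_sum fun j _ => mul_le_mul_of_nonneg_left (huv j) (hM i j)

theorem matPos_nonneg {m n : ℕ} (M : Matrix (Fin m) (Fin n) ℝ) (i j) : 0 ≤ matPos M i j :=
  le_max_left _ _

theorem matNeg_nonneg {m n : ℕ} (M : Matrix (Fin m) (Fin n) ℝ) (i j) : 0 ≤ matNeg M i j :=
  sub_nonneg.mpr (le_max_right _ _)

theorem matPos_mulVec_sub_matNeg_mulVec {m n : ℕ} (M : Matrix (Fin m) (Fin n) ℝ)
    (v : Fin n → ℝ) : matPos M *ᵥ v - matNeg M *ᵥ v = M *ᵥ v := by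
  rw [← Matrix.sub_mulVec, matNeg, sub_sub_cancel]

/-- Interval bounds for the image of a vector lying between `l` and `u`. -/
theorem mulVec_mem_interval {m n : ℕ} (M : Matrix (Fin m) (Fin n) ℝ)
    {l v u : Fin n → ℝ} (hl : l ≤ v) (hu : v ≤ u) :
    matPos M *ᵥ l - matNeg M *ᵥ u ≤ M *ᵥ v ∧ M *ᵥ v ≤ matPos M *ᵥ u - matNeg M *ᵥ l := by
  rw [← matPos_mulVec_sub_matNeg_mulVec M v]
  exact ⟨sub_le_sub (mulVec_le_mulVec_of_nonneg (matPos_nonneg M) hl)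
      (mulVec_le_mulVec_of_nonneg (matNeg_nonneg M) hu),
    sub_le_sub (mulVec_le_mulVec_of_nonneg (matPos_nonneg M) hu)
      (mulVec_le_mulVec_of_nonneg (matNeg_nonneg M) hl)⟩

/-- framing in the `z`-coordinates.  If `ẑ₀⁻ ≤ R₀ z₀ ≤ ẑ₀⁺` then
`ẑ_k⁻ ≤ R_k z_k ≤ ẑ_k⁺` for all `k`, and with `S_k = R_k⁻¹`, the vectors
`z_k⁻ = S_k⁺ ẑ_k⁻ − S_k⁻ ẑ_k⁺` and `z_k⁺ = S_k⁺ ẑ_k⁺ − S_k⁻ ẑ_k⁻` satisfy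
`z_k⁻ ≤ z_k ≤ z_k⁺` for all `k`. -/
theorem stmt10 {ny nz : ℕ}
    (A : Matrix (Fin nz) (Fin nz) ℝ) (B : Matrix (Fin nz) (Fin ny) ℝ)
    (R : ℕ → Matrix (Fin nz) (Fin nz) ℝ)
    (hR : ∀ k, IsUnit (R k).det)
    (hRnn : ∀ k, ∀ i j, 0 ≤ (R (k + 1) * A * (R k)⁻¹) i j)
    (y : ℕ → Fin ny → ℝ) (w wm wp : ℕ → Fin ny → ℝ)
    (hw : ∀ k, wm k ≤ w k ∧ w k ≤ wp k)
    (z zhp zhm : ℕ → Fin nz → ℝ)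
    (hz : ∀ k, z (k + 1) = A *ᵥ z k + B *ᵥ y k - B *ᵥ w k)
    (hzhp : ∀ k, zhp (k + 1) = (R (k + 1) * A * (R k)⁻¹) *ᵥ zhp k + (R (k + 1) * B) *ᵥ y k
        + matNeg (R (k + 1) * B) *ᵥ wp k - matPos (R (k + 1) * B) *ᵥ wm k)
    (hzhm : ∀ k, zhm (k + 1) = (R (k + 1) * A * (R k)⁻¹) *ᵥ zhm k + (R (k + 1) * B) *ᵥ y k
        + matNeg (R (k + 1) * B) *ᵥ wm k - matPos (R (k + 1) * B) *ᵥ wp k)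
    (h0 : zhm 0 ≤ R 0 *ᵥ z 0 ∧ R 0 *ᵥ z 0 ≤ zhp 0) :
    ∀ k : ℕ,
      (zhm k ≤ R k *ᵥ z k ∧ R k *ᵥ z k ≤ zhp k) ∧
      (matPos ((R k)⁻¹) *ᵥ zhm k - matNeg ((R k)⁻¹) *ᵥ zhp k ≤ z k ∧
        z k ≤ matPos ((R k)⁻¹) *ᵥ zhp k - matNeg ((R k)⁻¹) *ᵥ zhm k) := by
  have hS : ∀ k, (R k)⁻¹ *ᵥ (R k *ᵥ z k) = z k := fun k => by
    rw [Matrix.mulVec_mulVec, Matrix.nonsing_inv_mul _ (hR k), Matrix.one_mulVec]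
  have hframe : ∀ k, zhm k ≤ R k *ᵥ z k ∧ R k *ᵥ z k ≤ zhp k := by
    intro k
    induction k with
    | zero => exact h0
    | succ k ih =>
      have hstep : R (k + 1) *ᵥ z (k + 1) = (R (k + 1) * A * (R k)⁻¹) *ᵥ (R k *ᵥ z k)
          + (R (k + 1) * B) *ᵥ y k - (R (k + 1) * B) *ᵥ w k := by
        rw [hz, Matrix.mulVec_sub, Matrix.mulVec_add, ← Matrix.mulVec_mulVec _ _ (R k)⁻¹, hS]
        simp only [Matrix.mulVec_mulVec]
      obtain ⟨hl, hu⟩ := mulVec_mem_interval (R (k + 1) * B) (hw k).1 (hw k).2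
      have hm := mulVec_le_mulVec_of_nonneg (hRnn k) ih.1
      have hp := mulVec_le_mulVec_of_nonneg (hRnn k) ih.2
      rw [hstep, hzhm, hzhp]
      constructor
      · intro i
        have h₁ := hm i
        have h₂ := hu i
        simp only [Pi.add_apply, Pi.sub_apply] at h₁ h₂ ⊢
        linarith
      · intro i
        have h₁ := hp i
        have h₂ := hl i
        simp only [Pi.add_apply, Pi.sub_apply] at h₁ h₂ ⊢
        linarith
  intro k
  have h := mulVec_mem_interval (R k)⁻¹ (hframe k).1 (hframe k).2
  rw [hS] at h
  exact ⟨hframe k, h⟩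
end

section
/- Let X ⊆ ℝ^{n_x}, let T : X → ℝ^{n_z}, and let T* : ℝ^{n_z} → ℝ^{n_x} satisfy T*(T(x)) = x for all x ∈ X and be globally Lipschitz with constant c' > 0 with respect to the ∞-norms. Let x ∈ X and z⁻, z⁺ ∈ ℝ^{n_z} with z⁻ ≤ T(x) ≤ z⁺ and z⁻ ≤ z⁺ componentwise. Then for each i ∈ {1,…,n_x}: max{T*(z⁺)_i, T*(z⁻)_i} − c' · max_j(z_j⁺ − z_j⁻) ≤ x_i ≤ min{T*(z⁺)_i, T*(z⁻)_i} + c' · max_j(z_j⁺ − z_j⁻). -/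
/-- if `T* ∘ T = id` on `X`, `T*` is globally `c'`-Lipschitz for the
∞-norms, `x ∈ X` and `z⁻ ≤ T(x) ≤ z⁺` with `z⁻ ≤ z⁺`, then componentwise
`max{T*(z⁺)ᵢ, T*(z⁻)ᵢ} − c' maxⱼ(zⱼ⁺ − zⱼ⁻) ≤ xᵢ ≤ min{T*(z⁺)ᵢ, T*(z⁻)ᵢ} + c' maxⱼ(zⱼ⁺ − zⱼ⁻)`. -/
theorem stmt11 {nx nz : ℕ} (hnz : 0 < nz)
    (X : Set (Fin nx → ℝ))
    (T : (Fin nx → ℝ) → (Fin nz → ℝ)) (Ts : (Fin nz → ℝ) → (Fin nx → ℝ))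
    (hTs : ∀ x ∈ X, Ts (T x) = x)
    (c' : ℝ) (hc' : 0 < c')
    (hTslip : ∀ za zb, ‖Ts za - Ts zb‖ ≤ c' * ‖za - zb‖)
    (x : Fin nx → ℝ) (hx : x ∈ X)
    (zm zp : Fin nz → ℝ) (h₁ : zm ≤ T x) (h₂ : T x ≤ zp) (h₃ : zm ≤ zp) :
    ∀ i : Fin nx,
      max (Ts zp i) (Ts zm i) - c' * (⨆ j, (zp j - zm j)) ≤ x i ∧
      x i ≤ min (Ts zp i) (Ts zm i) + c' * (⨆ j, (zp j - zm j)) := by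
  have hle : ∀ j, zp j - zm j ≤ ⨆ j, (zp j - zm j) :=
    le_ciSup (Set.finite_range fun j => zp j - zm j).bddAbove
  have hnonneg : 0 ≤ ⨆ j, (zp j - zm j) :=
    (sub_nonneg.2 (h₃ ⟨0, hnz⟩)).trans (hle ⟨0, hnz⟩)
  have key : ∀ w, zm ≤ w → w ≤ zp → ∀ i,
      |Ts w i - x i| ≤ c' * ⨆ j, (zp j - zm j) := by
    intro w hw₁ hw₂ i
    have hnorm : ‖w - T x‖ ≤ ⨆ j, (zp j - zm j) := by
      refine (pi_norm_le_iff_of_nonneg hnonneg).2 fun j => ?_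
      rw [Real.norm_eq_abs, Pi.sub_apply, abs_le]
      constructor <;> linarith [hle j, h₁ j, h₂ j, hw₁ j, hw₂ j]
    have hcoord := norm_le_pi_norm (Ts w - Ts (T x)) i
    rw [Real.norm_eq_abs, Pi.sub_apply] at hcoord
    have hlip := hTslip w (T x)
    rw [hTs x hx] at hcoord hlip
    exact hcoord.trans (hlip.trans (mul_le_mul_of_nonneg_left hnorm hc'.le))
  intro i
  obtain ⟨hp₁, hp₂⟩ := abs_le.1 (key zp h₃ le_rfl i)
  obtain ⟨hm₁, hm₂⟩ := abs_le.1 (key zm le_rfl h₃ i)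
  constructor
  · rw [sub_le_iff_le_add]
    exact max_le (by linarith) (by linarith)
  · rw [← sub_le_iff_le_add]
    exact le_min (by linarith) (by linarith)
end
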